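/- Let d ≥ 1, let ᾱ = (α_1,...,α_d) ∈ ℝ^d be badly approximable with constant β > 0, let k be a positive integer, and let M = ⌊(1/2)(β² k / d³)^{d/2}⌋ with M ≥ 1. Then the discrepancy of the k-th convolution power of Q satisfies D(Q^{*k}) ≤ 9.9281 / (M + 1). -/

import Mathlib

open MeasureTheory Real
open scoped ENNReal

noncomputable section

/-- The generating measure `Q` on the circle `ℝ/ℤ` of the random walk generated by the
`d`-tuple `α`: mass `1/(2d)` at each point `α j mod 1` and `-α j mod 1`. -/
def circleQ {d : ℕ} (α : Fin d → ℝ) : Measure (AddCircle (1 : ℝ)) :=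
  ((2 * d : ℝ≥0∞))⁻¹ •
    ∑ j : Fin d, (Measure.dirac ((α j : ℝ) : AddCircle (1 : ℝ)) +
      Measure.dirac (((-(α j) : ℝ)) : AddCircle (1 : ℝ)))

/-- `k`-fold convolution power of a measure on the circle. -/
def convPow (μ : Measure (AddCircle (1 : ℝ))) : ℕ → Measure (AddCircle (1 : ℝ))
  | 0 => Measure.dirac 0
  | k + 1 => (convPow μ k).conv μ

/-- The discrepancy of a measure `P` on the circle: the supremum over all arcs
(connected subsets) `I` of `|P(I) - λ(I)|`, where `λ` is Haar (Lebesgue) probability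
measure (`volume` on `AddCircle 1`). -/
def discrepancy (P : Measure (AddCircle (1 : ℝ))) : ℝ :=
  sSup { r : ℝ | ∃ I : Set (AddCircle (1 : ℝ)), IsConnected I ∧
    r = |(P I).toReal - (volume I).toReal| }

/-- The `m`-th Fourier coefficient of a measure on the circle: `∫ e^{-2πimx} dP(x)`. -/
def fourierCoeffMeasure (P : Measure (AddCircle (1 : ℝ))) (m : ℤ) : ℂ :=
  ∫ x, fourier (-m) x ∂P

/-- Euclidean distance from `x ∈ ℝ^d` to the nearest integer lattice point. -/
def latticeDist {d : ℕ} (x : Fin d → ℝ) : ℝ :=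
  ⨅ v : Fin d → ℤ, Real.sqrt (∑ i, (x i - v i) ^ 2)

/-- `k`-th convolution powers of a probability measure are probability measures. -/
theorem isProbabilityMeasure_convPow (μ : Measure (AddCircle (1 : ℝ))) [IsProbabilityMeasure μ]
    (k : ℕ) : IsProbabilityMeasure (convPow μ k) := by
  induction k with
  | zero => simp only [convPow]; infer_instance
  | succ k ih => simp only [convPow]; infer_instance

theorem isProbabilityMeasure_circleQ {d : ℕ} (hd : 1 ≤ d) (α : Fin d → ℝ) :
    IsProbabilityMeasure (circleQ α) := by
  constructor
  have h0 : (2 * d : ℝ≥0∞) ≠ 0 := by simp; omega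
  have h1 : (2 * d : ℝ≥0∞) ≠ ⊤ := ENNReal.mul_ne_top (by simp) (by simp)
  have h2 : ((2 * d : ℝ≥0∞))⁻¹ * (d * (1 + 1)) = 1 := by
    rw [one_add_one_eq_two, mul_comm (d : ℝ≥0∞) 2]
    exact ENNReal.inv_mul_cancel h0 h1
  simpa [circleQ, mul_add] using h2

theorem fourierCoeffMeasure_conv (μ ν : Measure (AddCircle (1 : ℝ))) [IsProbabilityMeasure μ]
    [IsProbabilityMeasure ν] (m : ℤ) :
    fourierCoeffMeasure (μ.conv ν) m = fourierCoeffMeasure μ m * fourierCoeffMeasure ν m := by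
  unfold fourierCoeffMeasure Measure.conv
  rw [integral_map (by fun_prop) (by fun_prop), ← integral_prod_mul]
  congr 1
  ext z
  simp [fourier_apply, smul_add, AddCircle.toCircle_add]

theorem fourierCoeffMeasure_convPow (μ : Measure (AddCircle (1 : ℝ))) [IsProbabilityMeasure μ]
    (k : ℕ) (m : ℤ) :
    fourierCoeffMeasure (convPow μ k) m = fourierCoeffMeasure μ m ^ k := by
  induction k with
  | zero => simp [convPow, fourierCoeffMeasure]
  | succ k ih =>
    have := isProbabilityMeasure_convPow μ k
    rw [convPow, fourierCoeffMeasure_conv, ih, pow_succ]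

theorem fourierCoeffMeasure_circleQ {d : ℕ} (α : Fin d → ℝ) (m : ℤ) :
    fourierCoeffMeasure (circleQ α) m =
      (((d : ℝ)⁻¹ * ∑ j, Real.cos (2 * π * m * α j) : ℝ) : ℂ) := by
  have hi : ∀ x : AddCircle (1 : ℝ), Integrable (fun y => fourier (-m) y) (Measure.dirac x) :=
    fun x => integrable_dirac (by simp)
  unfold fourierCoeffMeasure circleQ
  rw [integral_smul_measure, integral_finsetSum_measure
    (fun j _ => (hi _).add_measure (hi _))]
  have : ∀ j, ∫ x, fourier (-m) x ∂(Measure.dirac ((α j : ℝ) : AddCircle (1 : ℝ)) +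
      Measure.dirac (((-(α j) : ℝ)) : AddCircle (1 : ℝ))) =
        2 * ((Real.cos (2 * π * m * α j) : ℝ) : ℂ) := by
    intro j
    rw [integral_add_measure (hi _) (hi _), integral_dirac, integral_dirac, fourier_coe_apply,
      fourier_coe_apply, Complex.ofReal_cos, Complex.two_cos, add_comm]
    congr 2 <;> push_cast <;> ring
  simp_rw [this]
  rw [← Finset.mul_sum, ENNReal.toReal_inv, ENNReal.toReal_mul]
  simp
  ring

/-- If `y` and `x` differ by an integer and `|y| ≤ 1/2`, then `|cos (π x)| ≤ 1 - 2 y²`. -/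
theorem abs_cos_pi_mul_le (x : ℝ) :
    |Real.cos (π * x)| ≤ 1 - 2 * (x - round x) ^ 2 := by
  have h1 : |Real.cos (π * x)| = Real.cos (π * (x - round x)) := by
    have h2 : |π * (x - round x)| ≤ π / 2 := by
      rw [abs_mul, abs_of_pos Real.pi_pos]
      nlinarith [abs_sub_round x, Real.pi_pos]
    have h3 := Real.cos_nonneg_of_mem_Icc ⟨(abs_le.1 h2).1, (abs_le.1 h2).2⟩
    rw [← abs_of_nonneg h3, mul_sub, mul_comm π (round x : ℝ), Real.cos_sub_int_mul_pi, abs_mul]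
    rcases Int.even_or_odd (round x) with h | h <;> simp [h.neg_one_zpow]
  rw [h1]
  have h2 : |π * (x - round x)| ≤ π := by
    rw [abs_mul, abs_of_pos Real.pi_pos]
    nlinarith [abs_sub_round x, Real.pi_pos]
  refine (Real.cos_le_one_sub_mul_cos_sq h2).trans (le_of_eq ?_)
  field_simp

theorem norm_fourierCoeffMeasure_circleQ_pow_le {d : ℕ} (hd : 1 ≤ d) (α : Fin d → ℝ) (k : ℕ)
    (m : ℤ) :
    ‖fourierCoeffMeasure (circleQ α) m ^ k‖ ≤
      Real.exp (-(2 * k / d * ∑ j, (2 * m * α j - round (2 * m * α j)) ^ 2)) := by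
  have hd' : (0 : ℝ) < d := by exact_mod_cast hd
  set S := ∑ j, (2 * m * α j - round (2 * m * α j)) ^ 2 with hS
  have h : ‖fourierCoeffMeasure (circleQ α) m‖ ≤ Real.exp (-(2 / d * S)) := by
    rw [fourierCoeffMeasure_circleQ, Complex.norm_real, Real.norm_eq_abs, abs_mul,
      abs_of_pos (by positivity)]
    calc (d : ℝ)⁻¹ * |∑ j, Real.cos (2 * π * m * α j)|
        ≤ (d : ℝ)⁻¹ * ∑ j : Fin d, (1 - 2 * (2 * m * α j - round (2 * m * α j)) ^ 2) := by
          gcongr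
          refine (Finset.abs_sum_le_sum_abs _ _).trans (Finset.sum_le_sum fun j _ => ?_)
          have := abs_cos_pi_mul_le (2 * m * α j)
          rwa [show π * (2 * m * α j) = 2 * π * m * α j by ring] at this
      _ = -(2 / d * S) + 1 := by
          rw [Finset.sum_sub_distrib, ← Finset.mul_sum, ← hS]
          simp
          field_simp
          ring
      _ ≤ _ := Real.add_one_le_exp _
  rw [norm_pow]
  calc _ ≤ Real.exp (-(2 / d * S)) ^ k := by gcongr
    _ = _ := by
      rw [← Real.exp_nat_mul]
      congr 1
      ring

/-- The closed arc of the circle that is the image of `[a, b]`. -/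
def arc (a b : ℝ) : Set (AddCircle (1 : ℝ)) :=
  (fun x : ℝ => (x : AddCircle (1 : ℝ))) '' Set.Icc a b

theorem measurableSet_arc (a b : ℝ) : MeasurableSet (arc a b) :=
  (isCompact_Icc.image (AddCircle.continuous_mk' 1)).isClosed.measurableSet

theorem arc_add_one (a : ℝ) : arc a (a + 1) = Set.univ :=
  AddCircle.coe_image_Icc_eq 1 a

theorem arc_mono {a b a' b' : ℝ} (ha : a' ≤ a) (hb : b ≤ b') : arc a b ⊆ arc a' b' :=
  Set.image_mono (Set.Icc_subset_Icc ha hb)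

theorem compl_arc_subset (a b : ℝ) : (arc a b)ᶜ ⊆ arc b (a + 1) := by
  intro x hx
  have : x ∈ arc a (a + 1) := by rw [arc_add_one]; trivial
  obtain ⟨y, hy, rfl⟩ := this
  refine ⟨y, ⟨?_, hy.2⟩, rfl⟩
  by_contra! h
  exact hx ⟨y, ⟨hy.1, h.le⟩, rfl⟩

theorem add_mem_arc_iff (x : AddCircle (1 : ℝ)) (t a b : ℝ) :
    x + (t : AddCircle (1 : ℝ)) ∈ arc a b ↔ x ∈ arc (a - t) (b - t) := by
  constructor
  · rintro ⟨y, hy, h⟩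
    refine ⟨y - t, ⟨by linarith [hy.1], by linarith [hy.2]⟩, ?_⟩
    simp only at h ⊢
    rw [AddCircle.coe_sub, h, add_sub_cancel_right]
  · rintro ⟨y, hy, rfl⟩
    exact ⟨y + t, ⟨by linarith [hy.1], by linarith [hy.2]⟩, AddCircle.coe_add _ _ _⟩

theorem setIntegral_arc {E : Type*} [NormedAddCommGroup E] [NormedSpace ℝ E]
    (f : AddCircle (1 : ℝ) → E) {a b : ℝ} (hab : a ≤ b) (hb : b < a + 1) :
    ∫ x in arc a b, f x = ∫ x in a..b, f x := by
  obtain ⟨c, hca, hbc⟩ : ∃ c, c < a ∧ b < c + 1 := ⟨(a + b - 1) / 2, by linarith, by linarith⟩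
  rw [← integral_indicator (measurableSet_arc a b), ← AddCircle.integral_preimage 1 c,
    intervalIntegral.integral_of_le hab, ← integral_Icc_eq_integral_Ioc (x := a) (y := b),
    ← Set.inter_eq_right.2 (show Set.Icc a b ⊆ Set.Ioc c (c + 1) from
      fun x hx => ⟨by linarith [hx.1], by linarith [hx.2]⟩),
    ← setIntegral_indicator measurableSet_Icc]
  refine setIntegral_congr_fun measurableSet_Ioc fun x hx => ?_
  have h : (x : AddCircle (1 : ℝ)) ∈ arc a b ↔ x ∈ Set.Icc a b := by
    refine ⟨?_, fun h => ⟨x, h, rfl⟩⟩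
    rintro ⟨y, hy, hyx⟩
    have : y = x := (AddCircle.coe_eq_coe_iff_of_mem_Ioc (a := c)
      ⟨by linarith [hy.1], by linarith [hy.2]⟩ hx).1 hyx
    rwa [← this]
  by_cases hx' : x ∈ Set.Icc a b
  · rw [Set.indicator_of_mem (h.2 hx'), Set.indicator_of_mem hx']
  · rw [Set.indicator_of_notMem (fun h' => hx' (h.1 h')), Set.indicator_of_notMem hx']

instance isProbabilityMeasure_volume_addCircle_one :
    IsProbabilityMeasure (volume : Measure (AddCircle (1 : ℝ))) :=
  ⟨by simp⟩

theorem volume_real_arc_le {a b : ℝ} (hab : a ≤ b) (hb : b ≤ a + 1) :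
    (volume : Measure (AddCircle (1 : ℝ))).real (arc a b) ≤ b - a := by
  rcases hb.eq_or_lt with rfl | h
  · simp [measureReal_le_one]
  · have := setIntegral_arc (fun _ => (1 : ℝ)) hab h
    simp only [setIntegral_const, smul_eq_mul, mul_one, intervalIntegral.integral_const] at this
    exact this.le

theorem norm_setIntegral_arc_fourier_le {m : ℤ} (hm : m ≠ 0) {a b : ℝ} (hab : a ≤ b)
    (hb : b < a + 1) :
    ‖∫ x in arc a b, fourier m x‖ ≤ 1 / (π * m.natAbs) := by
  have hm' : (m : ℂ) ≠ 0 := by exact_mod_cast hm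
  have hc : (2 * π * Complex.I * m : ℂ) ≠ 0 := by simp [Real.pi_ne_zero, hm]
  have hn : ∀ x : ℝ, ‖Complex.exp (2 * π * Complex.I * m * x)‖ = 1 := fun x => by
    rw [show (2 * π * Complex.I * m * x : ℂ) = ((2 * π * m * x : ℝ) : ℂ) * Complex.I by
      push_cast; ring]
    exact Complex.norm_exp_ofReal_mul_I _
  rw [setIntegral_arc _ hab hb]
  simp_rw [fourier_coe_apply, Complex.ofReal_one, div_one]
  rw [integral_exp_mul_complex hc, norm_div]
  have h1 : ‖(2 * π * Complex.I * m : ℂ)‖ = 2 * (π * m.natAbs) := by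
    simp [abs_of_pos Real.pi_pos, Nat.cast_natAbs]
    ring
  have h2 : 0 < π * (m.natAbs : ℝ) := by
    have : 0 < m.natAbs := Int.natAbs_pos.2 hm
    positivity
  rw [h1, div_le_div_iff₀ (by positivity) h2, one_mul]
  gcongr
  refine (norm_sub_le _ _).trans ?_
  rw [hn, hn]
  norm_num

theorem integral_fourier_eq_ite (m : ℤ) :
    ∫ x : AddCircle (1 : ℝ), fourier m x = if m = 0 then 1 else 0 := by
  split_ifs with h
  · subst h
    simp
  · exact integral_eq_zero_of_add_right_eq_neg (fourier_add_half_inv_index h one_pos)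

/-- The Fejér kernel of order `n`. -/
def fejerKernel (n : ℕ) (t : AddCircle (1 : ℝ)) : ℝ :=
  ‖∑ j ∈ Finset.range n, fourier (j : ℤ) t‖ ^ 2 / n

theorem fejerKernel_nonneg (n : ℕ) (t : AddCircle (1 : ℝ)) : 0 ≤ fejerKernel n t := by
  unfold fejerKernel
  positivity

theorem continuous_fejerKernel (n : ℕ) : Continuous (fejerKernel n) := by
  unfold fejerKernel
  fun_prop

theorem integrable_of_continuous_addCircle {E : Type*} [NormedAddCommGroup E]
    {f : AddCircle (1 : ℝ) → E} (hf : Continuous f) : Integrable f :=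
  hf.integrable_of_hasCompactSupport (HasCompactSupport.of_compactSpace f)

theorem fejerKernel_eq_sum (n : ℕ) (t : AddCircle (1 : ℝ)) :
    (fejerKernel n t : ℂ) =
      (∑ j ∈ Finset.range n, ∑ l ∈ Finset.range n, fourier ((j : ℤ) - l) t) / n := by
  unfold fejerKernel
  push_cast
  rw [← Complex.mul_conj', map_sum, Finset.sum_mul_sum]
  simp_rw [← fourier_neg, ← fourier_add, ← sub_eq_add_neg]

theorem integral_fejerKernel {n : ℕ} (hn : 0 < n) : ∫ t, fejerKernel n t = 1 := by
  have hi : ∀ m : ℤ, Integrable (fun t : AddCircle (1 : ℝ) => fourier m t) :=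
    fun m => integrable_of_continuous_addCircle (by fun_prop)
  have hn' : (n : ℂ) ≠ 0 := by exact_mod_cast hn.ne'
  have h : (∫ t, (fejerKernel n t : ℂ)) = 1 := by
    simp_rw [fejerKernel_eq_sum]
    rw [integral_div, integral_finsetSum _ fun j _ => integrable_finsetSum _ fun l _ => hi _]
    simp_rw [integral_finsetSum _ fun l _ => hi _, integral_fourier_eq_ite, sub_eq_zero,
      Nat.cast_inj]
    simp only [Finset.sum_ite_eq, Finset.mem_range]
    rw [Finset.sum_congr rfl fun j hj => if_pos (Finset.mem_range.1 hj)]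
    simp [hn']
  rw [integral_complex_ofReal] at h
  exact_mod_cast h

theorem fejerKernel_coe_le (n : ℕ) {x : ℝ} (hx : |x| ≤ 1 / 2) (hx0 : x ≠ 0) :
    fejerKernel n (x : AddCircle (1 : ℝ)) ≤ 1 / (4 * n * x ^ 2) := by
  set z : ℂ := fourier 1 (x : AddCircle (1 : ℝ)) with hz
  have hpow : ∀ j : ℕ, fourier (j : ℤ) (x : AddCircle (1 : ℝ)) = z ^ j := by
    intro j
    simp [hz, fourier_apply, AddCircle.toCircle_nsmul]
  have hz1 : ‖z‖ = 1 := by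
    rw [hz, fourier_apply]
    exact Circle.norm_coe _
  have h1 : 4 * |x| ≤ ‖z - 1‖ := by
    have h2 : z = Complex.exp (Complex.I * (2 * π * x : ℝ)) := by
      rw [hz, fourier_coe_apply]
      congr 1
      push_cast
      ring
    have h3 : |2 * π * x / 2| ≤ π / 2 := by
      rw [show 2 * π * x / 2 = π * x by ring, abs_mul, abs_of_pos Real.pi_pos]
      nlinarith [Real.pi_pos]
    have h4 := Real.mul_abs_le_abs_sin h3
    rw [h2, Complex.norm_exp_I_mul_ofReal_sub_one, norm_mul, Real.norm_eq_abs, Real.norm_eq_abs]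
    rw [show |2 * π * x / 2| = π * |x| by
      rw [show 2 * π * x / 2 = π * x by ring, abs_mul, abs_of_pos Real.pi_pos]] at h4
    rw [show 2 / π * (π * |x|) = 2 * |x| by field_simp] at h4
    rw [abs_two]
    linarith
  have h2 : ‖∑ j ∈ Finset.range n, fourier (j : ℤ) (x : AddCircle (1 : ℝ))‖ * (4 * |x|) ≤ 2 := by
    simp_rw [hpow]
    calc _ ≤ ‖∑ j ∈ Finset.range n, z ^ j‖ * ‖z - 1‖ := by gcongr
      _ = ‖z ^ n - 1‖ := by rw [← norm_mul, geom_sum_mul]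
      _ ≤ 2 := by
        refine (norm_sub_le _ _).trans ?_
        rw [norm_pow, hz1]
        norm_num
  have hx' : 0 < |x| := abs_pos.2 hx0
  unfold fejerKernel
  rcases Nat.eq_zero_or_pos n with rfl | hn
  · simp
  have hn' : (0 : ℝ) < n := by exact_mod_cast hn
  rw [div_le_div_iff₀ hn' (by positivity)]
  have h3 := pow_le_pow_left₀ (by positivity) h2 2
  rw [mul_pow, mul_pow, sq_abs] at h3
  nlinarith

/-- The mass of the Fejér kernel outside the `s`-neighbourhood of the origin. -/
theorem setIntegral_fejerKernel_le (n : ℕ) {s : ℝ} (hs : 0 < s) :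
    ∫ t in {t : AddCircle (1 : ℝ) | s < ‖t‖}, fejerKernel n t ≤ 1 / (2 * n * s) := by
  have hS : MeasurableSet {t : AddCircle (1 : ℝ) | s < ‖t‖} :=
    measurableSet_lt measurable_const measurable_norm
  set f : ℝ → ℝ := Set.indicator (Set.Ioi s) (fun x => (4 * n : ℝ)⁻¹ * x ^ (-2 : ℝ)) with hf
  have hfi : IntegrableOn f (Set.Ioi 0) := by
    refine Integrable.integrableOn ?_
    rw [hf, integrable_indicator_iff measurableSet_Ioi]
    exact (integrableOn_Ioi_rpow_of_lt (by norm_num) hs).const_mul _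
  have hfi' : Integrable (fun x => f |x|) := by
    rw [← integrableOn_univ, ← Set.Iic_union_Ioi (a := (0 : ℝ))]
    have h1 : IntegrableOn (fun x => f |x|) (Set.Ioi 0) :=
      hfi.congr_fun (fun x hx => by rw [abs_of_pos hx]) measurableSet_Ioi
    refine IntegrableOn.union ?_ h1
    rw [← integrableOn_Ici_iff_integrableOn_Ioi, ← neg_zero] at h1
    have := h1.comp_neg_Iic
    simpa using this
  have hf0 : ∀ x, 0 ≤ f |x| := by
    intro x
    refine Set.indicator_nonneg (fun y hy => ?_) _
    have : (0 : ℝ) < y := hs.trans hy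
    positivity
  rw [← integral_indicator hS, ← AddCircle.integral_preimage 1 (-(1 / 2))]
  calc _ ≤ ∫ x in Set.Ioc (-(1 / 2) : ℝ) (-(1 / 2) + 1), f |x| := by
        refine setIntegral_mono_on ?_ hfi'.integrableOn measurableSet_Ioc fun x hx => ?_
        · have := (AddCircle.measurePreserving_mk 1 (-(1 / 2))).integrable_comp
            (((integrable_of_continuous_addCircle
              (continuous_fejerKernel n)).indicator hS).aestronglyMeasurable)
          exact this.2 ((integrable_of_continuous_addCircle
            (continuous_fejerKernel n)).indicator hS)
        · have hx' : |x| ≤ 1 / 2 := abs_le.2 ⟨hx.1.le, by linarith [hx.2]⟩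
          have hnorm : ‖(x : AddCircle (1 : ℝ))‖ = |x| :=
            (AddCircle.norm_coe_eq_abs_iff 1 one_ne_zero).2 (by simpa using hx')
          by_cases h : s < |x|
          · rw [Set.indicator_of_mem (by simpa [hnorm] using h), hf,
              Set.indicator_of_mem (by simpa using h)]
            have h0 : 0 < |x| := hs.trans h
            refine (fejerKernel_coe_le n hx' (abs_pos.1 h0)).trans (le_of_eq ?_)
            rw [Real.rpow_neg h0.le, Real.rpow_two, sq_abs, ← mul_inv, one_div]
          · rw [Set.indicator_of_notMem (by simpa [hnorm] using h)]
            exact hf0 x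
    _ ≤ ∫ x, f |x| := setIntegral_le_integral hfi' (Filter.Eventually.of_forall hf0)
    _ = 2 * ∫ x in Set.Ioi 0, f x := integral_comp_abs
    _ = 2 * ∫ x in Set.Ioi s, (4 * n : ℝ)⁻¹ * x ^ (-2 : ℝ) := by
        rw [hf, setIntegral_indicator measurableSet_Ioi, Set.Ioi_inter_Ioi, max_eq_right hs.le]
    _ = _ := by
        rw [integral_const_mul, integral_Ioi_rpow_of_lt (by norm_num) hs]
        norm_num
        rw [Real.rpow_neg_one]
        ring

theorem measurable_measureReal_translate (P : Measure (AddCircle (1 : ℝ)))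
    [IsProbabilityMeasure P] {E : Set (AddCircle (1 : ℝ))} (hE : MeasurableSet E) :
    Measurable fun t => P.real {x | x + t ∈ E} := by
  have hS : MeasurableSet {z : AddCircle (1 : ℝ) × AddCircle (1 : ℝ) | z.2 + z.1 ∈ E} :=
    (show Measurable fun z : AddCircle (1 : ℝ) × AddCircle (1 : ℝ) => z.2 + z.1 by fun_prop) hE
  exact (measurable_measure_prodMk_left hS).ennreal_toReal

theorem integrable_mul_measureReal_translate (P : Measure (AddCircle (1 : ℝ)))
    [IsProbabilityMeasure P] {E : Set (AddCircle (1 : ℝ))} (hE : MeasurableSet E)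
    {f : AddCircle (1 : ℝ) → ℂ} (hf : Continuous f) :
    Integrable fun t => f t * (P.real {x | x + t ∈ E} : ℂ) := by
  refine (integrable_of_continuous_addCircle hf).mul_bdd (c := 1)
    (Complex.measurable_ofReal.comp
      (measurable_measureReal_translate P hE)).aestronglyMeasurable
    (Filter.Eventually.of_forall fun t => ?_)
  rw [Complex.norm_real, Real.norm_of_nonneg measureReal_nonneg]
  exact measureReal_le_one

theorem integral_fourier_mul_measureReal_translate (P : Measure (AddCircle (1 : ℝ)))
    [IsProbabilityMeasure P] {E : Set (AddCircle (1 : ℝ))} (hE : MeasurableSet E) (m : ℤ) :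
    ∫ t, fourier m t * (P.real {x | x + t ∈ E} : ℂ) =
      fourierCoeffMeasure P m * ∫ y in E, fourier m y := by
  have hmeas : Measurable fun z : AddCircle (1 : ℝ) × AddCircle (1 : ℝ) => z.2 + z.1 := by
    fun_prop
  have hprod : Integrable (Function.uncurry fun t x : AddCircle (1 : ℝ) =>
      fourier m t * E.indicator (fun _ => (1 : ℂ)) (x + t)) (volume.prod P) := by
    refine Integrable.of_bound (C := 1) ?_ (Filter.Eventually.of_forall fun z => ?_)
    · refine Measurable.aestronglyMeasurable ?_
      exact ((fourier m).continuous.measurable.comp measurable_fst).mul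
        ((measurable_const.indicator hE).comp hmeas)
    · simp only [Function.uncurry, norm_mul]
      have h1 : ‖fourier m z.1‖ = 1 := by
        rw [fourier_apply]
        exact Circle.norm_coe _
      rw [h1, one_mul]
      by_cases h : z.2 + z.1 ∈ E <;> simp [h]
  have hinner : ∀ t : AddCircle (1 : ℝ), fourier m t * (P.real {x | x + t ∈ E} : ℂ) =
      ∫ x, fourier m t * E.indicator (fun _ => (1 : ℂ)) (x + t) ∂P := by
    intro t
    rw [integral_const_mul]
    congr 1
    have hEt : MeasurableSet {x | x + t ∈ E} := (measurable_add_const t) hE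
    have := integral_indicator_const (μ := P) (1 : ℂ) hEt
    rw [Complex.real_smul, mul_one] at this
    rw [← this]
    rfl
  simp_rw [hinner]
  rw [integral_integral_swap hprod]
  unfold fourierCoeffMeasure
  rw [← integral_mul_const]
  congr 1
  ext x
  have := integral_add_left_eq_self (μ := (volume : Measure (AddCircle (1 : ℝ))))
    (fun y => fourier m (y - x) * E.indicator (fun _ => (1 : ℂ)) y) x
  simp only [add_sub_cancel_left] at this
  rw [this, ← integral_indicator hE, ← integral_const_mul]
  congr 1
  ext y
  by_cases h : y ∈ E
  · simp only [Set.indicator_of_mem h, mul_one]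
    simp only [fourier_apply, sub_eq_add_neg, zsmul_add, zsmul_neg, neg_zsmul,
      AddCircle.toCircle_add, Circle.coe_mul, mul_comm]
  · simp [h]

theorem integral_fejerKernel_mul_measureReal_translate (P : Measure (AddCircle (1 : ℝ)))
    [IsProbabilityMeasure P] {E : Set (AddCircle (1 : ℝ))} (hE : MeasurableSet E) (n : ℕ) :
    ((∫ t, fejerKernel n t * P.real {x | x + t ∈ E} : ℝ) : ℂ) =
      (∑ j ∈ Finset.range n, ∑ l ∈ Finset.range n,
        fourierCoeffMeasure P ((j : ℤ) - l) * ∫ y in E, fourier ((j : ℤ) - l) y) / n := by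
  have hi : ∀ m : ℤ, Integrable fun t => fourier m t * (P.real {x | x + t ∈ E} : ℂ) :=
    fun m => integrable_mul_measureReal_translate P hE (by fun_prop)
  rw [← integral_complex_ofReal]
  push_cast
  simp_rw [fejerKernel_eq_sum, div_mul_eq_mul_div, Finset.sum_mul]
  rw [integral_div, integral_finsetSum _ fun j _ => integrable_finsetSum _ fun l _ => hi _]
  simp_rw [integral_finsetSum _ fun l _ => hi _,
    integral_fourier_mul_measureReal_translate P hE]

theorem norm_fourierCoeffMeasure_neg (P : Measure (AddCircle (1 : ℝ))) (m : ℤ) :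
    ‖fourierCoeffMeasure P (-m)‖ = ‖fourierCoeffMeasure P m‖ := by
  unfold fourierCoeffMeasure
  rw [← RCLike.norm_conj, ← integral_conj]
  congr 2
  ext x
  rw [← fourier_neg, neg_neg]

theorem norm_fourierCoeffMeasure_natAbs (P : Measure (AddCircle (1 : ℝ))) (m : ℤ) :
    ‖fourierCoeffMeasure P m.natAbs‖ = ‖fourierCoeffMeasure P m‖ := by
  rcases Int.natAbs_eq m with h | h
  · rw [← h]
  · rw [← norm_fourierCoeffMeasure_neg, ← h]

theorem sum_natAbs_sub_le (b : ℕ → ℝ) (hb : ∀ m, 0 ≤ b m) (hb0 : b 0 = 0) {n j : ℕ} (hj : j < n) :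
    ∑ l ∈ Finset.range n, b ((j : ℤ) - l).natAbs ≤ 2 * ∑ m ∈ Finset.Icc 1 (n - 1), b m := by
  have h1 : ∑ l ∈ Finset.range j, b ((j : ℤ) - l).natAbs ≤ ∑ m ∈ Finset.Icc 1 (n - 1), b m := by
    have hinj : Set.InjOn (fun l : ℕ => ((j : ℤ) - l).natAbs) (Finset.range j) := by
      intro x hx y hy hxy
      simp only [Finset.coe_range, Set.mem_Iio] at hx hy hxy
      omega
    rw [← Finset.sum_image (f := b) hinj]
    refine Finset.sum_le_sum_of_subset_of_nonneg (fun m hm => ?_) fun _ _ _ => hb _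
    obtain ⟨l, hl, rfl⟩ := Finset.mem_image.1 hm
    simp only [Finset.mem_range, Finset.mem_Icc] at hl ⊢
    omega
  have h2 : ∑ l ∈ Finset.Ico (j + 1) n, b ((j : ℤ) - l).natAbs ≤
      ∑ m ∈ Finset.Icc 1 (n - 1), b m := by
    have hinj : Set.InjOn (fun l : ℕ => ((j : ℤ) - l).natAbs) (Finset.Ico (j + 1) n) := by
      intro x hx y hy hxy
      simp only [Finset.coe_Ico, Set.mem_Ico] at hx hy hxy
      omega
    rw [← Finset.sum_image (f := b) hinj]
    refine Finset.sum_le_sum_of_subset_of_nonneg (fun m hm => ?_) fun _ _ _ => hb _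
    obtain ⟨l, hl, rfl⟩ := Finset.mem_image.1 hm
    simp only [Finset.mem_Ico, Finset.mem_Icc] at hl ⊢
    omega
  rw [← Finset.sum_range_add_sum_Ico _ hj, Finset.sum_range_succ, sub_self, Int.natAbs_zero, hb0]
  linarith

/-- Smoothing an arc by the Fejér kernel costs at most a weighted sum of Fourier coefficients. -/
theorem integral_fejerKernel_mul_measureReal_arc_le (P : Measure (AddCircle (1 : ℝ)))
    [IsProbabilityMeasure P] {n : ℕ} (hn : 0 < n) {a b : ℝ} (hab : a ≤ b) (hb : b < a + 1) :
    ∫ t, fejerKernel n t * P.real {x | x + t ∈ arc a b} ≤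
      (b - a) + 2 / π * ∑ m ∈ Finset.Icc 1 (n - 1), ‖fourierCoeffMeasure P m‖ / m := by
  have hn' : (0 : ℝ) < n := by exact_mod_cast hn
  have hnc : (n : ℂ) ≠ 0 := by exact_mod_cast hn.ne'
  set I := ∫ t, fejerKernel n t * P.real {x | x + t ∈ arc a b} with hI
  set T := ∑ m ∈ Finset.Icc 1 (n - 1), ‖fourierCoeffMeasure P m‖ / m with hT
  set w : ℤ → ℂ := fun m => fourierCoeffMeasure P m * ∫ y in arc a b, fourier m y with hw
  have hw0 : w 0 = ((b - a : ℝ) : ℂ) := by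
    rw [hw]
    simp only [setIntegral_arc _ hab hb]
    simp [fourierCoeffMeasure]
  have hwm : ∀ m : ℤ, ‖w m - if m = 0 then ((b - a : ℝ) : ℂ) else 0‖ ≤
      1 / π * (‖fourierCoeffMeasure P m.natAbs‖ / m.natAbs) := by
    intro m
    split_ifs with hm
    · subst hm
      simp [hw0]
    · rw [sub_zero, norm_mul, norm_fourierCoeffMeasure_natAbs]
      calc _ ≤ ‖fourierCoeffMeasure P m‖ * (1 / (π * m.natAbs)) := by
            gcongr
            exact norm_setIntegral_arc_fourier_le hm hab hb
        _ = _ := by rw [one_div, mul_inv]; ring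
  have hsum : ((I - (b - a) : ℝ) : ℂ) = (∑ j ∈ Finset.range n, ∑ l ∈ Finset.range n,
      (w ((j : ℤ) - l) - if (j : ℤ) - l = 0 then ((b - a : ℝ) : ℂ) else 0)) / n := by
    simp_rw [Finset.sum_sub_distrib, sub_eq_zero, Nat.cast_inj]
    have hdiag : ∑ j ∈ Finset.range n, ∑ l ∈ Finset.range n,
        (if j = l then ((b - a : ℝ) : ℂ) else 0) = n * ((b - a : ℝ) : ℂ) := by
      simp only [Finset.sum_ite_eq, Finset.mem_range]
      rw [Finset.sum_congr rfl fun j hj => if_pos (Finset.mem_range.1 hj)]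
      simp
      ring
    rw [hdiag, sub_div, mul_div_cancel_left₀ _ hnc, Complex.ofReal_sub, hI,
      integral_fejerKernel_mul_measureReal_translate P (measurableSet_arc a b)]
  have hnorm : |I - (b - a)| ≤ 2 / π * T := by
    rw [← Real.norm_eq_abs, ← Complex.norm_real, hsum, norm_div, Complex.norm_natCast,
      div_le_iff₀ hn']
    calc _ ≤ ∑ j ∈ Finset.range n, ∑ l ∈ Finset.range n,
          1 / π * (‖fourierCoeffMeasure P ((j : ℤ) - l).natAbs‖ / ((j : ℤ) - l).natAbs) := by
          refine norm_sum_le_of_le _ fun j _ => norm_sum_le_of_le _ fun l _ => hwm _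
      _ ≤ ∑ j ∈ Finset.range n, 1 / π * (2 * T) := by
          refine Finset.sum_le_sum fun j hj => ?_
          rw [← Finset.mul_sum]
          gcongr
          exact sum_natAbs_sub_le (fun m : ℕ => ‖fourierCoeffMeasure P m‖ / m)
            (fun m => by positivity) (by simp) (Finset.mem_range.1 hj)
      _ = _ := by
          rw [Finset.sum_const, Finset.card_range, nsmul_eq_mul]
          ring
  linarith [le_abs_self (I - (b - a))]

/-- A bound `Δ` for the excess mass of all arcs can be improved to a third of itself plus the
Erdős–Turán terms. -/
theorem measureReal_arc_sub_le_of_forall (P : Measure (AddCircle (1 : ℝ)))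
    [IsProbabilityMeasure P] {n : ℕ} (hn : 0 < n) {Δ : ℝ} (hΔ0 : 0 ≤ Δ)
    (hΔ : ∀ a b : ℝ, a ≤ b → b ≤ a + 1 → P.real (arc a b) - (b - a) ≤ Δ)
    {a b : ℝ} (hab : a ≤ b) :
    P.real (arc a b) - (b - a) ≤ 4 / n +
      8 / (3 * π) * (∑ m ∈ Finset.Icc 1 (n - 1), ‖fourierCoeffMeasure P m‖ / m) + Δ / 3 := by
  have hn' : (0 : ℝ) < n := by exact_mod_cast hn
  set T := ∑ m ∈ Finset.Icc 1 (n - 1), ‖fourierCoeffMeasure P m‖ / m with hT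
  have hT0 : 0 ≤ T := Finset.sum_nonneg fun m _ => by positivity
  have hT' : 0 ≤ 8 / (3 * π) * T := by positivity
  set s : ℝ := 2 / n with hs
  have hs0 : 0 < s := by positivity
  have h4 : 4 / (n : ℝ) = 2 * s := by rw [hs]; ring
  rw [h4]
  by_cases hfull : a + 1 ≤ b + 2 * s
  · have := measureReal_le_one (μ := P) (s := arc a b)
    linarith
  push Not at hfull
  by_cases hp : P.real (arc a b) - (b - a) ≤ 2 * s
  · linarith
  push Not at hp
  set p := P.real (arc a b) - (b - a) with hpdef
  have hup := integral_fejerKernel_mul_measureReal_arc_le P hn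
    (a := a - s) (b := b + s) (by linarith) (by linarith)
  rw [← hT] at hup
  set A : Set (AddCircle (1 : ℝ)) := {t | s < ‖t‖} with hA
  have hAm : MeasurableSet A := measurableSet_lt measurable_const measurable_norm
  have hE := measurableSet_arc (a - s) (b + s)
  set L := b + s - (a - s) with hL
  have hpt : ∀ t : AddCircle (1 : ℝ),
      (p - 2 * s + L) * fejerKernel n t - (p - 2 * s + Δ) * A.indicator (fejerKernel n) t ≤
        fejerKernel n t * P.real {x | x + t ∈ arc (a - s) (b + s)} := by
    intro t
    have hK := fejerKernel_nonneg n t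
    obtain ⟨τ, hτ, rfl⟩ : t ∈ (fun x : ℝ => (x : AddCircle (1 : ℝ))) ''
        Set.Ioc (-(1 / 2)) (-(1 / 2) + 1) := by
      rw [AddCircle.coe_image_Ioc_eq]
      trivial
    simp only at hK ⊢
    have hset : {x : AddCircle (1 : ℝ) | x + (τ : AddCircle (1 : ℝ)) ∈ arc (a - s) (b + s)} =
        arc (a - s - τ) (b + s - τ) := by
      ext x
      exact add_mem_arc_iff x τ _ _
    rw [hset]
    by_cases ht : (τ : AddCircle (1 : ℝ)) ∈ A
    · rw [Set.indicator_of_mem ht]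
      have h1 := hΔ (b + s - τ) (a - s - τ + 1) (by linarith) (by linarith)
      have h2 : P.real (arc (a - s - τ) (b + s - τ))ᶜ ≤
          P.real (arc (b + s - τ) (a - s - τ + 1)) := measureReal_mono (compl_arc_subset _ _)
      rw [probReal_compl_eq_one_sub (measurableSet_arc _ _)] at h2
      have h3 : L - Δ ≤ P.real (arc (a - s - τ) (b + s - τ)) := by linarith
      nlinarith
    · rw [Set.indicator_of_notMem ht]
      have hnorm : ‖(τ : AddCircle (1 : ℝ))‖ = |τ| :=
        (AddCircle.norm_coe_eq_abs_iff 1 one_ne_zero).2 (by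
          rw [abs_one]
          exact abs_le.2 ⟨hτ.1.le, by linarith [hτ.2]⟩)
      have hτs : |τ| ≤ s := by
        rw [← hnorm]
        exact not_lt.1 ht
      obtain ⟨h1, h2⟩ := abs_le.1 hτs
      have h3 : P.real (arc a b) ≤ P.real (arc (a - s - τ) (b + s - τ)) :=
        measureReal_mono (arc_mono (by linarith) (by linarith))
      have h4 : p - 2 * s + L ≤ P.real (arc (a - s - τ) (b + s - τ)) := by linarith
      nlinarith
  have hKi := integrable_of_continuous_addCircle (continuous_fejerKernel n)
  have hlow := integral_mono
    ((hKi.const_mul (p - 2 * s + L)).sub ((hKi.indicator hAm).const_mul (p - 2 * s + Δ)))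
    (hKi.mul_bdd (c := 1) (measurable_measureReal_translate P hE).aestronglyMeasurable
      (Filter.Eventually.of_forall fun t => by
        rw [Real.norm_of_nonneg measureReal_nonneg]
        exact measureReal_le_one)) hpt
  simp only [Pi.sub_apply] at hlow
  rw [integral_sub (hKi.const_mul _) ((hKi.indicator hAm).const_mul _), integral_const_mul,
    integral_const_mul, integral_fejerKernel hn, integral_indicator hAm] at hlow
  have htail := setIntegral_fejerKernel_le n hs0
  rw [← hA, hs, show 1 / (2 * (n : ℝ) * (2 / n)) = 1 / 4 by field_simp; norm_num] at htail
  have h5 : 8 / (3 * π) * T = 4 / 3 * (2 / π * T) := by ring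
  rw [h5]
  have h6 : (p - 2 * s + Δ) * ∫ t in A, fejerKernel n t ≤ (p - 2 * s + Δ) * (1 / 4) := by
    have : 0 ≤ p - 2 * s + Δ := by linarith
    gcongr
  linarith

/-- An Erdős–Turán inequality for the excess mass of arcs. -/
theorem measureReal_arc_sub_le (P : Measure (AddCircle (1 : ℝ))) [IsProbabilityMeasure P]
    {n : ℕ} (hn : 0 < n) {a b : ℝ} (hab : a ≤ b) (hb : b ≤ a + 1) :
    P.real (arc a b) - (b - a) ≤ 6 / n +
      4 / π * ∑ m ∈ Finset.Icc 1 (n - 1), ‖fourierCoeffMeasure P m‖ / m := by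
  set T := ∑ m ∈ Finset.Icc 1 (n - 1), ‖fourierCoeffMeasure P m‖ / m with hT
  set S : Set ℝ := {r | ∃ a b : ℝ, a ≤ b ∧ b ≤ a + 1 ∧ r = P.real (arc a b) - (b - a)} with hS
  have hbdd : BddAbove S := by
    refine ⟨1, ?_⟩
    rintro _ ⟨a, b, h, -, rfl⟩
    have := measureReal_le_one (μ := P) (s := arc a b)
    linarith
  have h0 : (0 : ℝ) ∈ S := ⟨0, 0 + 1, by norm_num, le_rfl, by rw [arc_add_one]; simp⟩
  have hle : ∀ a b : ℝ, a ≤ b → b ≤ a + 1 → P.real (arc a b) - (b - a) ≤ sSup S :=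
    fun a b h h' => le_csSup hbdd ⟨a, b, h, h', rfl⟩
  have hsup : sSup S ≤ 4 / n + 8 / (3 * π) * T + sSup S / 3 := by
    refine csSup_le ⟨0, h0⟩ ?_
    rintro _ ⟨a, b, h, -, rfl⟩
    exact measureReal_arc_sub_le_of_forall P hn (le_csSup hbdd h0) hle h
  have h1 : 4 / π * T = 3 / 2 * (8 / (3 * π) * T) := by
    field_simp
    ring
  have h2 : 6 / (n : ℝ) = 3 / 2 * (4 / n) := by ring
  linarith [hle a b hab hb]

/-- A proper nonempty connected subset of the circle agrees with a closed arc up to endpoints. -/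
theorem exists_arc_of_isConnected {I : Set (AddCircle (1 : ℝ))} (hI : IsConnected I)
    (hI' : I ≠ Set.univ) :
    ∃ a b : ℝ, a ≤ b ∧ b ≤ a + 1 ∧ I ⊆ arc a b ∧ Iᶜ ⊆ arc b (a + 1) := by
  obtain ⟨q, hq⟩ := (Set.ne_univ_iff_exists_notMem I).1 hI'
  obtain ⟨p, rfl⟩ := QuotientAddGroup.mk_surjective q
  set e := AddCircle.openPartialHomeomorphCoe (1 : ℝ) p with he
  have hIt : I ⊆ e.target := fun x hx h => hq (by
    rw [Set.mem_singleton_iff] at h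
    exact h ▸ hx)
  set J := e.symm '' I with hJ
  have hJc : J.OrdConnected :=
    (hI.isPreconnected.image _ (e.continuousOn_symm.mono hIt)).ordConnected
  have hJs : J ⊆ Set.Ioo p (p + 1) := by
    rintro _ ⟨x, hx, rfl⟩
    exact e.map_target (hIt hx)
  have hJmem : ∀ y ∈ J, (y : AddCircle (1 : ℝ)) ∈ I := by
    rintro _ ⟨x, hx, rfl⟩
    have : e (e.symm x) = x := e.right_inv (hIt hx)
    change e (e.symm x) ∈ I
    rwa [this]
  have hJne : J.Nonempty := hI.nonempty.image _
  have hbelow : BddBelow J := ⟨p, fun y hy => (hJs hy).1.le⟩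
  have habove : BddAbove J := ⟨p + 1, fun y hy => (hJs hy).2.le⟩
  have h1 : p ≤ sInf J := le_csInf hJne fun y hy => (hJs hy).1.le
  have h2 : sSup J ≤ p + 1 := csSup_le hJne fun y hy => (hJs hy).2.le
  refine ⟨sInf J, sSup J, csInf_le_csSup hJne hbelow habove, by linarith, ?_, ?_⟩
  · intro x hx
    have hxJ : e.symm x ∈ J := ⟨x, hx, rfl⟩
    exact ⟨e.symm x, ⟨csInf_le hbelow hxJ, le_csSup habove hxJ⟩, e.right_inv (hIt hx)⟩
  · intro x hx
    have : x ∈ (fun x : ℝ => (x : AddCircle (1 : ℝ))) '' Set.Ioc (sInf J) (sInf J + 1) := by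
      rw [AddCircle.coe_image_Ioc_eq]
      trivial
    obtain ⟨y, hy, rfl⟩ := this
    refine ⟨y, ⟨?_, hy.2⟩, rfl⟩
    by_contra! h
    obtain ⟨u, hu, huy⟩ := exists_lt_of_csInf_lt hJne hy.1
    obtain ⟨v, hv, hyv⟩ := exists_lt_of_lt_csSup hJne h
    exact hx (hJmem y (hJc.out hu hv ⟨huy.le, hyv.le⟩))

theorem discrepancy_le_of_forall_arc (P : Measure (AddCircle (1 : ℝ))) [IsProbabilityMeasure P]
    {B : ℝ} (hB : ∀ a b : ℝ, a ≤ b → b ≤ a + 1 → P.real (arc a b) - (b - a) ≤ B) :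
    discrepancy P ≤ B := by
  have hB0 : 0 ≤ B := by
    have := hB 0 (0 + 1) (by norm_num) le_rfl
    rw [arc_add_one] at this
    simpa using this
  refine csSup_le ⟨_, {0}, isConnected_singleton, rfl⟩ ?_
  rintro _ ⟨I, hI, rfl⟩
  by_cases hu : I = Set.univ
  · subst hu
    simpa using hB0
  obtain ⟨a, b, hab, hb, hsub, hcompl⟩ := exists_arc_of_isConnected hI hu
  have htot : ∀ μ : Measure (AddCircle (1 : ℝ)), IsProbabilityMeasure μ →
      1 ≤ μ.real I + μ.real Iᶜ := by
    intro μ _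
    have := measureReal_union_le (μ := μ) I Iᶜ
    rwa [Set.union_compl_self, probReal_univ] at this
  have hP := htot P inferInstance
  have hV := htot volume inferInstance
  have hPI : P.real I ≤ P.real (arc a b) := measureReal_mono hsub
  have hPc : P.real Iᶜ ≤ P.real (arc b (a + 1)) := measureReal_mono hcompl
  have hVI : volume.real I ≤ volume.real (arc a b) := measureReal_mono hsub
  have hVc : volume.real Iᶜ ≤ volume.real (arc b (a + 1)) := measureReal_mono hcompl
  have h1 := hB a b hab hb
  have h2 := hB b (a + 1) hb (by linarith)
  have h3 := volume_real_arc_le hab hb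
  have h4 := volume_real_arc_le hb (by linarith : a + 1 ≤ b + 1)
  change |P.real I - volume.real I| ≤ B
  exact abs_le.2 ⟨by linarith, by linarith⟩

/-- An Erdős–Turán inequality on the circle. -/
theorem discrepancy_le_erdos_turan (P : Measure (AddCircle (1 : ℝ))) [IsProbabilityMeasure P]
    {n : ℕ} (hn : 0 < n) :
    discrepancy P ≤ 6 / n +
      4 / π * ∑ m ∈ Finset.Icc 1 (n - 1), ‖fourierCoeffMeasure P m‖ / m :=
  discrepancy_le_of_forall_arc P fun _ _ hab hb => measureReal_arc_sub_le P hn hab hb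

/-- The distance from the unit cell `[c, c + 1)` to the origin. -/
def cellDist : ℤ → ℕ
  | Int.ofNat n => n
  | Int.negSucc n => n

theorem cellDist_floor_le_sq (z : ℝ) : (cellDist ⌊z⌋ : ℝ) ≤ z ^ 2 := by
  have hn : ∀ n : ℕ, (n : ℝ) ≤ (n : ℝ) ^ 2 := fun n => by
    exact_mod_cast Nat.le_self_pow two_ne_zero n
  have h1 := Int.floor_le z
  have h2 := Int.lt_floor_add_one z
  generalize ⌊z⌋ = c at *
  rcases c with n | n
  · simp only [cellDist, Int.ofNat_eq_natCast, Int.cast_natCast] at *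
    refine (hn n).trans ?_
    gcongr
  · simp only [cellDist, Int.cast_negSucc] at *
    push_cast at h2
    refine (hn n).trans ?_
    rw [← neg_sq z]
    gcongr
    linarith

theorem sum_exp_neg_cellDist_le (s : Finset ℤ) :
    ∑ c ∈ s, Real.exp (-(cellDist c : ℝ)) ≤ 3.2 := by
  have he := Real.exp_one_gt_d9
  have hr0 : 0 ≤ Real.exp (-1) := (Real.exp_pos _).le
  have hr : Real.exp (-1) ≤ 0.37 := by
    rw [Real.exp_neg]
    rw [inv_le_comm₀ (by positivity) (by norm_num)]
    norm_num at he ⊢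
    linarith
  have hgeo := hasSum_geometric_of_lt_one hr0 (by linarith)
  have hs := hgeo.int_rec hgeo
  have hq : ∀ c : ℤ, Real.exp (-(cellDist c : ℝ)) =
      Int.rec (motive := fun _ => ℝ) (fun n => Real.exp (-1) ^ n)
        (fun n => Real.exp (-1) ^ n) c := by
    intro c
    rcases c with n | n <;> simp [cellDist, ← Real.exp_nat_mul]
  simp_rw [hq]
  refine (sum_le_hasSum s (fun c _ => ?_) hs).trans ?_
  · rw [← hq]
    positivity
  · have : (1 - Real.exp (-1))⁻¹ ≤ 1.6 := by
      rw [inv_le_comm₀ (by linarith) (by norm_num)]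
      norm_num at hr ⊢
      linarith
    linarith

/-- A sum of product weights over distinct cells is at most a power of the one-dimensional sum. -/
theorem sum_prod_le_pow_of_injOn {ι : Type*} {d : ℕ} (S : Finset ι) (c : ι → Fin d → ℤ)
    (hc : Set.InjOn c S) (q : ℤ → ℝ) (hq : ∀ z, 0 ≤ q z) (K : ℝ)
    (hK : ∀ s : Finset ℤ, ∑ z ∈ s, q z ≤ K) :
    ∑ m ∈ S, ∏ j, q (c m j) ≤ K ^ d := by
  classical
  calc ∑ m ∈ S, ∏ j, q (c m j) = ∑ v ∈ S.image c, ∏ j, q (v j) := by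
        rw [Finset.sum_image hc]
    _ ≤ ∑ v ∈ Fintype.piFinset (fun j => S.image (fun m => c m j)), ∏ j, q (v j) := by
        refine Finset.sum_le_sum_of_subset_of_nonneg ?_ fun v _ _ =>
          Finset.prod_nonneg fun j _ => hq _
        intro v hv
        obtain ⟨m, hm, rfl⟩ := Finset.mem_image.1 hv
        exact Fintype.mem_piFinset.2 fun j => Finset.mem_image_of_mem _ hm
    _ = ∏ j : Fin d, ∑ z ∈ S.image (fun m => c m j), q z := by
        rw [Finset.prod_univ_sum]
    _ ≤ ∏ _j : Fin d, K :=
        Finset.prod_le_prod (fun j _ => Finset.sum_nonneg fun z _ => hq z) fun j _ => hK _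
    _ = K ^ d := by simp

theorem sq_le_sum_sq_of_badly_approximable {d : ℕ} {α : Fin d → ℝ} {β : ℝ} (hβ : 0 < β)
    (hbad : ∀ N : ℕ, 0 < N →
      β / (N : ℝ) ^ ((1 : ℝ) / d) ≤ latticeDist (fun i => (N : ℝ) * α i))
    {N : ℕ} (hN : 0 < N) (v : Fin d → ℤ) :
    β ^ 2 / (N : ℝ) ^ ((2 : ℝ) / d) ≤ ∑ j, (N * α j - v j) ^ 2 := by
  have h1 : β / (N : ℝ) ^ ((1 : ℝ) / d) ≤ Real.sqrt (∑ j, (N * α j - v j) ^ 2) :=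
    (hbad N hN).trans (ciInf_le ⟨0, by rintro _ ⟨w, rfl⟩; positivity⟩ v)
  have h2 := pow_le_pow_left₀ (by positivity) h1 2
  rw [Real.sq_sqrt (by positivity), div_pow, ← Real.rpow_natCast ((N : ℝ) ^ _),
    ← Real.rpow_mul (by positivity),
    show (1 : ℝ) / d * (2 : ℕ) = 2 / d by push_cast; ring] at h2
  exact h2

theorem sum_exp_div_le {d : ℕ} (hd : 1 ≤ d) (α : Fin d → ℝ) (β : ℝ) (hβ : 0 < β)
    (hbad : ∀ N : ℕ, 0 < N →
      β / (N : ℝ) ^ ((1 : ℝ) / d) ≤ latticeDist (fun i => (N : ℝ) * α i))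
    (k M : ℕ) (hM : 1 ≤ M) (hkM : (d : ℝ) ^ 3 * (2 * M : ℝ) ^ ((2 : ℝ) / d) ≤ β ^ 2 * k) :
    ∑ m ∈ Finset.Icc 1 M, Real.exp (-(2 * k / d * ∑ j, (2 * m * α j - round (2 * m * α j)) ^ 2)) / m
      ≤ 1.18 / M := by
  have hd1 : (1 : ℝ) ≤ d := by exact_mod_cast hd
  have hd0 : (0 : ℝ) < d := by linarith
  have hM1 : (1 : ℝ) ≤ M := by exact_mod_cast hM
  have hM0 : (0 : ℝ) < M := by linarith
  set y : ℕ → Fin d → ℝ := fun m j => 2 * m * α j - round (2 * m * α j) with hy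
  set R : ℝ := (2 * M : ℝ) ^ ((2 : ℝ) / d) with hR
  have hR0 : 0 < R := by positivity
  -- the side of the cells
  set h : ℝ := Real.sqrt (β ^ 2 / (R * d)) with hh
  have hh0 : 0 < h := by positivity
  have hhsq : h ^ 2 = β ^ 2 / (R * d) := Real.sq_sqrt (by positivity)
  have hlat : ∀ N : ℕ, 0 < N → N ≤ M → ∀ v : Fin d → ℤ,
      β ^ 2 / (2 * N : ℝ) ^ ((2 : ℝ) / d) ≤ ∑ j, (2 * N * α j - v j) ^ 2 := by
    intro N hN _ v
    have := sq_le_sum_sq_of_badly_approximable hβ hbad (N := 2 * N) (by omega) v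
    push_cast at this
    exact this
  set c : ℕ → Fin d → ℤ := fun m j => ⌊y m j / h⌋ with hc
  have hinj : Set.InjOn c (Finset.Icc 1 M) := by
    have key : ∀ a b : ℕ, 1 ≤ a → a < b → b ≤ M → c a ≠ c b := by
      intro a b ha hab hb hcab
      have h1 := hlat (b - a) (by omega) (by omega)
        (fun j => round (2 * b * α j) - round (2 * a * α j))
      have h2 : β ^ 2 / R ≤ β ^ 2 / (2 * (b - a : ℕ) : ℝ) ^ ((2 : ℝ) / d) := by
        have : (0 : ℝ) < (b - a : ℕ) := by exact_mod_cast (by omega : 0 < b - a)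
        rw [hR]
        gcongr
        omega
      have h3 : ∑ j : Fin d, (2 * (b - a : ℕ) * α j -
          ((round (2 * b * α j) - round (2 * a * α j) : ℤ) : ℝ)) ^ 2 < ∑ _j : Fin d, h ^ 2 := by
        have : Nonempty (Fin d) := ⟨⟨0, hd⟩⟩
        refine Finset.sum_lt_sum_of_nonempty Finset.univ_nonempty fun j _ => ?_
        have h4 : c a j = c b j := congrFun hcab j
        have h5 := Int.abs_sub_lt_one_of_floor_eq_floor h4
        rw [← sub_div, abs_div, abs_of_pos hh0, div_lt_one hh0] at h5
        rw [← sq_abs]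
        have h6 : 2 * ((b - a : ℕ) : ℝ) * α j -
          ((round (2 * b * α j) - round (2 * a * α j) : ℤ) : ℝ) = -(y a j - y b j) := by
          rw [Nat.cast_sub hab.le]
          simp only [hy]
          push_cast
          ring
        rw [h6, abs_neg]
        gcongr
      have h7 : ∑ _j : Fin d, h ^ 2 = β ^ 2 / R := by
        rw [Finset.sum_const, Finset.card_univ, Fintype.card_fin, nsmul_eq_mul, hhsq]
        field_simp
      linarith
    intro a ha b hb hab
    simp only [Finset.coe_Icc, Set.mem_Icc] at ha hb
    rcases lt_trichotomy a b with hlt | heq | hlt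
    · exact absurd hab (key a b ha.1 hlt hb.2)
    · exact heq
    · exact absurd hab.symm (key b a hb.1 hlt ha.2)
  have hterm : ∀ m ∈ Finset.Icc 1 M,
      Real.exp (-(2 * k / d * ∑ j, (y m j) ^ 2)) / m ≤
        Real.exp (-(d : ℝ) ^ 2) / M * ∏ j, Real.exp (-(cellDist (c m j) : ℝ)) := by
    intro m hm
    obtain ⟨hm1, hm2⟩ := Finset.mem_Icc.1 hm
    have hm0 : (0 : ℝ) < m := by exact_mod_cast hm1
    have hmM : (m : ℝ) ≤ M := by exact_mod_cast hm2
    have hfirst : (d : ℝ) ^ 2 + Real.log (M / m) ≤ k / d * ∑ j, (y m j) ^ 2 := by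
      have hlog : 0 ≤ Real.log (M / m : ℝ) := Real.log_nonneg (by rwa [one_le_div hm0])
      have h1 : β ^ 2 / (2 * m : ℝ) ^ ((2 : ℝ) / d) ≤ ∑ j, (y m j) ^ 2 :=
        hlat m hm1 hm2 (fun j => round (2 * m * α j))
      have h2 : 2 / d * Real.log (M / m) + 1 ≤ (M / m : ℝ) ^ ((2 : ℝ) / d) := by
        rw [Real.rpow_def_of_pos (by positivity), mul_comm (Real.log _)]
        exact Real.add_one_le_exp _
      have h3 : (M / m : ℝ) ^ ((2 : ℝ) / d) = R / (2 * m : ℝ) ^ ((2 : ℝ) / d) := by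
        rw [hR, ← Real.div_rpow (by positivity) (by positivity), mul_div_mul_left _ _ two_ne_zero]
      calc (d : ℝ) ^ 2 + Real.log (M / m)
          ≤ (d : ℝ) ^ 2 + 2 * d * Real.log (M / m) := by nlinarith
        _ = (d : ℝ) ^ 2 * (2 / d * Real.log (M / m) + 1) := by field_simp; ring
        _ ≤ (d : ℝ) ^ 2 * (R / (2 * m : ℝ) ^ ((2 : ℝ) / d)) := by rw [← h3]; gcongr
        _ = (d : ℝ) ^ 3 * R / d / (2 * m : ℝ) ^ ((2 : ℝ) / d) := by field_simp
        _ ≤ β ^ 2 * k / d / (2 * m : ℝ) ^ ((2 : ℝ) / d) := by gcongr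
        _ = k / d * (β ^ 2 / (2 * m : ℝ) ^ ((2 : ℝ) / d)) := by ring
        _ ≤ _ := by gcongr
    have hsecond : ∑ j, (cellDist (c m j) : ℝ) ≤ k / d * ∑ j, (y m j) ^ 2 := by
      rw [Finset.mul_sum]
      refine Finset.sum_le_sum fun j _ => ?_
      have h1 : (1 : ℝ) ≤ k / d * h ^ 2 := by
        rw [hhsq, div_mul_div_comm, one_le_div (by positivity)]
        calc (d : ℝ) * (R * d) ≤ (d : ℝ) ^ 3 * R := by
              have : (d : ℝ) * (R * d) * 1 ≤ (d : ℝ) * (R * d) * d := by gcongr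
              linarith
          _ ≤ _ := by linarith
      calc (cellDist (c m j) : ℝ) ≤ (y m j / h) ^ 2 := cellDist_floor_le_sq _
        _ = 1 * (y m j / h) ^ 2 := (one_mul _).symm
        _ ≤ k / d * h ^ 2 * (y m j / h) ^ 2 := by gcongr
        _ = _ := by field_simp
    rw [← Real.exp_sum, Finset.sum_neg_distrib]
    have h3 : Real.exp (-(2 * k / d * ∑ j, (y m j) ^ 2)) ≤
        Real.exp (-(d : ℝ) ^ 2) * (m / M) * Real.exp (-∑ j, (cellDist (c m j) : ℝ)) := by
      have h4 : (m / M : ℝ) = Real.exp (-Real.log (M / m)) := by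
        rw [Real.exp_neg, Real.exp_log (by positivity), inv_div]
      rw [h4, ← Real.exp_add, ← Real.exp_add]
      gcongr
      have : 2 * k / d * ∑ j, (y m j) ^ 2 =
        k / d * ∑ j, (y m j) ^ 2 + k / d * ∑ j, (y m j) ^ 2 := by ring
      linarith
    rw [div_le_iff₀ hm0]
    refine h3.trans (le_of_eq ?_)
    ring
  have hpow : Real.exp (-(d : ℝ) ^ 2) * 3.2 ^ d ≤ 1.18 := by
    have he := Real.exp_one_gt_d9
    have hr : Real.exp (-1) ≤ 0.368 := by
      rw [Real.exp_neg, inv_le_comm₀ (by positivity) (by norm_num)]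
      norm_num at he ⊢
      linarith
    have h1 : Real.exp (-(d : ℝ) ^ 2) * 3.2 ^ d = (Real.exp (-d) * 3.2) ^ d := by
      rw [mul_pow, ← Real.exp_nat_mul]
      ring_nf
    rw [h1]
    rcases hd.eq_or_lt with rfl | h2
    · norm_num at hr ⊢
      linarith
    · have h3 : Real.exp (-(d : ℝ)) ≤ 0.368 ^ 2 := by
        have : (2 : ℝ) ≤ d := by exact_mod_cast h2
        calc Real.exp (-(d : ℝ)) ≤ Real.exp (-1 + -1) := by gcongr; linarith
          _ = Real.exp (-1) ^ 2 := by rw [Real.exp_add, sq]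
          _ ≤ _ := by gcongr
      have h4 : (Real.exp (-(d : ℝ)) * 3.2) ^ d ≤ 1 :=
        pow_le_one₀ (by positivity) (by norm_num at h3 ⊢; linarith)
      norm_num at h4 ⊢
      linarith
  calc _ ≤ ∑ m ∈ Finset.Icc 1 M,
        Real.exp (-(d : ℝ) ^ 2) / M * ∏ j, Real.exp (-(cellDist (c m j) : ℝ)) :=
        Finset.sum_le_sum hterm
    _ ≤ Real.exp (-(d : ℝ) ^ 2) / M * 3.2 ^ d := by
        rw [← Finset.mul_sum]
        gcongr
        exact sum_prod_le_pow_of_injOn _ c hinj (fun z => Real.exp (-(cellDist z : ℝ)))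
          (fun z => (Real.exp_pos _).le) _ sum_exp_neg_cellDist_le
    _ = Real.exp (-(d : ℝ) ^ 2) * 3.2 ^ d / M := by ring
    _ ≤ _ := by gcongr

/-- Discrepancy upper bound in terms of `M = ⌊(1/2)(β²k/d³)^{d/2}⌋`. -/
theorem discrepancy_le_of_M
    {d : ℕ} (hd : 1 ≤ d) (α : Fin d → ℝ) (β : ℝ) (hβ : 0 < β)
    (hbad : ∀ N : ℕ, 0 < N →
      β / (N : ℝ) ^ ((1 : ℝ) / d) ≤ latticeDist (fun i => (N : ℝ) * α i))
    (k : ℕ) (hk : 0 < k) (M : ℕ)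
    (hM : M = ⌊(1 / 2 : ℝ) * (β ^ 2 * k / d ^ 3) ^ ((d : ℝ) / 2)⌋₊) (hM1 : 1 ≤ M) :
    discrepancy (convPow (circleQ α) k) ≤ 9.9281 / ((M : ℝ) + 1) := by
  have hprob := isProbabilityMeasure_circleQ hd α
  have hprob' := isProbabilityMeasure_convPow (circleQ α) k
  have hd0 : (0 : ℝ) < d := by exact_mod_cast hd
  have hk0 : (0 : ℝ) < k := by exact_mod_cast hk
  have hM1' : (1 : ℝ) ≤ M := by exact_mod_cast hM1
  have hkM : (d : ℝ) ^ 3 * (2 * M : ℝ) ^ ((2 : ℝ) / d) ≤ β ^ 2 * k := by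
    have h1 : (M : ℝ) ≤ (1 / 2 : ℝ) * (β ^ 2 * k / d ^ 3) ^ ((d : ℝ) / 2) := by
      rw [hM]
      exact Nat.floor_le (by positivity)
    have h2 : (2 * M : ℝ) ^ ((2 : ℝ) / d) ≤ β ^ 2 * k / d ^ 3 := by
      calc (2 * M : ℝ) ^ ((2 : ℝ) / d)
          ≤ ((β ^ 2 * k / d ^ 3) ^ ((d : ℝ) / 2)) ^ ((2 : ℝ) / d) := by
            gcongr
            linarith
        _ = β ^ 2 * k / d ^ 3 := by
            rw [← Real.rpow_mul (by positivity), div_mul_div_cancel₀ two_ne_zero,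
              div_self hd0.ne', Real.rpow_one]
    rw [le_div_iff₀ (by positivity)] at h2
    linarith
  have hT : ∑ m ∈ Finset.Icc 1 M, ‖fourierCoeffMeasure (convPow (circleQ α) k) m‖ / m ≤
      1.18 / M := by
    refine (Finset.sum_le_sum fun m _ => ?_).trans (sum_exp_div_le hd α β hβ hbad k M hM1 hkM)
    gcongr
    rw [fourierCoeffMeasure_convPow]
    exact_mod_cast norm_fourierCoeffMeasure_circleQ_pow_le hd α k m
  have hET := discrepancy_le_erdos_turan (convPow (circleQ α) k) (n := M + 1) (by omega)
  rw [Nat.add_sub_cancel] at hET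
  push_cast at hET
  have hTM : (1.18 : ℝ) / M ≤ 2.36 / (M + 1) := by
    rw [div_le_div_iff₀ (by positivity) (by positivity)]
    linarith
  have hpi : 4 / π ≤ 4 / 3 := by
    gcongr
    exact Real.pi_gt_three.le
  calc _ ≤ 6 / ((M : ℝ) + 1) + 4 / 3 * (2.36 / (M + 1)) := by
        refine hET.trans ?_
        gcongr
        exact hT.trans hTM
    _ = (6 + 4 / 3 * 2.36) / ((M : ℝ) + 1) := by ring
    _ ≤ _ := by
        gcongr
        norm_num

end
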